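/- Each generating invariant T of the Pieri algebras (the unique SL_m(ℂ)-invariant in ∧^i(ℂ^m) ⊗ ℂ^m ⊗ ∧^j(ℂ^m) with i + 1 + j ≡ 0 mod m, or in ∧^i(ℂ^m) ⊗ ∧^{m-1}(ℂ^m) ⊗ ∧^j(ℂ^m), or in ∧^i(ℂ^m) ⊗ ∧^j(ℂ^m) with i + j ≡ 0 mod m) has level valuation v_θ(T) = 1. -/

import Mathlib

set_option synthInstance.maxHeartbeats 1000000
set_option maxHeartbeats 1000000

open MvPolynomial TensorProduct

noncomputable section RepCore

/-- The polynomial ring `ℂ[x_{ij}]` of functions on `m × m` matrices. -/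
abbrev PolyR (m : ℕ) := MvPolynomial (Fin m × Fin m) ℂ

/-- The group `SL_m(ℂ)`. -/
abbrev SLm (m : ℕ) := Matrix.SpecialLinearGroup (Fin m) ℂ

/-- Right translation action of `SL_m(ℂ)` on functions on matrices:
`(g • f)(x) = f(xg)`. -/
def actA {m : ℕ} (g : SLm m) : PolyR m →ₐ[ℂ] PolyR m :=
  aeval (fun p : Fin m × Fin m => ∑ k : Fin m, C (g.val k p.2) * X (p.1, k))

/-- The leading principal `k × k` minor, as a polynomial function on matrices. -/
def minorP (m k : ℕ) (hk : k ≤ m) : PolyR m :=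
  (Matrix.of (fun i j : Fin k => (X (Fin.castLE hk i, Fin.castLE hk j) : PolyR m))).det

/-- An `SL_m` dominant weight `λ = (λ_1 ≥ … ≥ λ_{m-1})`, `m = n+1`, padded by `λ_m = 0`. -/
def padWt {n : ℕ} (l : Fin n → ℕ) : Fin (n + 1) → ℕ := Fin.snoc l 0

/-- The highest weight vector of `V(λ)`: the product of leading principal minors with
exponents `λ_k - λ_{k+1}`. -/
def hwv {n : ℕ} (l : Fin n → ℕ) : PolyR (n + 1) :=
  ∏ k : Fin n,
    (minorP (n + 1) (k + 1) (by omega)) ^ (padWt l k.castSucc - padWt l k.succ)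

/-- The irreducible representation `V(λ)` of `SL_m(ℂ)`, realized as the span of the
`SL_m(ℂ)`-translates of the highest weight vector inside `ℂ[x_{ij}]`. -/
def Virr {n : ℕ} (l : Fin n → ℕ) : Submodule ℂ (PolyR (n + 1)) :=
  Submodule.span ℂ {f | ∃ g : SLm (n + 1), f = actA g (hwv l)}

/-- The triple tensor product of copies of `ℂ[x_{ij}]`. -/
abbrev T3 (m : ℕ) := PolyR m ⊗[ℂ] (PolyR m ⊗[ℂ] PolyR m)

/-- The diagonal action of `g ∈ SL_m(ℂ)` on the triple tensor product. -/
def bigAct {m : ℕ} (g : SLm m) : T3 m →ₗ[ℂ] T3 m :=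
  TensorProduct.map (actA g).toLinearMap
    (TensorProduct.map (actA g).toLinearMap (actA g).toLinearMap)

/-- The image of `A ⊗ B ⊗ C` inside the triple tensor product. -/
def tens3 {m : ℕ} (A B C : Submodule ℂ (PolyR m)) : Submodule ℂ (T3 m) :=
  Submodule.span ℂ {x | ∃ a ∈ A, ∃ b ∈ B, ∃ c ∈ C, x = a ⊗ₜ[ℂ] (b ⊗ₜ[ℂ] c)}

/-- The `SL_m(ℂ)`-invariant vectors in the triple tensor product. -/
def InvT3 (m : ℕ) : Submodule ℂ (T3 m) :=
  ⨅ g : SLm m, LinearMap.eqLocus (bigAct g) LinearMap.id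

/-- `dim (V(λ) ⊗ V(η) ⊗ V(μ))^{SL_m(ℂ)}`. -/
def invDim {n : ℕ} (l e h : Fin n → ℕ) : Cardinal :=
  Module.rank ℂ ↥(tens3 (Virr l) (Virr e) (Virr h) ⊓ InvT3 (n + 1))

/-- The raising operator `e_θ` of the `sl_2`-triple attached to the longest root
`θ = α_{1m}`, acting on functions on matrices (by right-invariant derivation). -/
def opE (n : ℕ) : PolyR (n + 1) →ₗ[ℂ] PolyR (n + 1) :=
  ∑ i : Fin (n + 1),
    (LinearMap.mulLeft ℂ (X (i, (0 : Fin (n + 1))))).comp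
      (pderiv (i, Fin.last n)).toLinearMap

/-- The lowering operator `f_θ`. -/
def opF (n : ℕ) : PolyR (n + 1) →ₗ[ℂ] PolyR (n + 1) :=
  ∑ i : Fin (n + 1),
    (LinearMap.mulLeft ℂ (X (i, Fin.last n))).comp
      (pderiv (i, (0 : Fin (n + 1)))).toLinearMap

/-- The coweight operator `h_θ`. -/
def opH (n : ℕ) : PolyR (n + 1) →ₗ[ℂ] PolyR (n + 1) :=
  (∑ i : Fin (n + 1),
    (LinearMap.mulLeft ℂ (X (i, (0 : Fin (n + 1))))).comp
      (pderiv (i, (0 : Fin (n + 1)))).toLinearMap) -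
  (∑ i : Fin (n + 1),
    (LinearMap.mulLeft ℂ (X (i, Fin.last n))).comp
      (pderiv (i, Fin.last n)).toLinearMap)

/-- The isotypical component of highest weight `d` for the `sl_2(θ)`-action inside a
subspace `N`: the span of the strings `f_θ^k v` over highest weight vectors `v ∈ N` of
weight `d`. -/
def isoty (n : ℕ) (N : Submodule ℂ (PolyR (n + 1))) (d : ℕ) :
    Submodule ℂ (PolyR (n + 1)) :=
  Submodule.span ℂ {f | ∃ (v : PolyR (n + 1)) (k : ℕ), v ∈ N ∧ opE n v = 0 ∧
    opH n v = (d : ℂ) • v ∧ f = ((opF n) ^ k) v}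

/-- Ueno's subspace `W_K = ⊕_{i+j+k ≤ 2K} W_i ⊗ W_j ⊗ W_k` of the triple tensor
product, where `W_i` is the `sl_2(θ)`-isotypical component of highest weight `i`. -/
def WKsub (n K : ℕ) : Submodule ℂ (T3 (n + 1)) :=
  ⨆ (i : ℕ) (j : ℕ) (k : ℕ) (_ : i + j + k ≤ 2 * K),
    tens3 (isoty n ⊤ i) (isoty n ⊤ j) (isoty n ⊤ k)

/-- The dimension of the space of level-`K` conformal blocks
`V_{0,3}(λ, η, μ, K) = W_K ∩ (V(λ) ⊗ V(η) ⊗ V(μ))^{SL_m(ℂ)}` (Ueno). -/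
def cbDim {n : ℕ} (l e h : Fin n → ℕ) (K : ℕ) : Cardinal :=
  Module.rank ℂ ↥(tens3 (Virr l) (Virr e) (Virr h) ⊓ InvT3 (n + 1) ⊓ WKsub n K)

/-- The level valuation `v_θ(T) = min {K : T ∈ W_K}`, with `v_θ(0) = ⊥ = -∞`. -/
def vtheta {n : ℕ} (T : T3 (n + 1)) : WithBot ℕ :=
  haveI := Classical.propDecidable (T = 0)
  if T = 0 then ⊥ else ((sInf {K : ℕ | T ∈ WKsub n K} : ℕ) : WithBot ℕ)

/-- The weight `r·ω_1 = (r, 0, …, 0)`. -/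
def wtOmega1 (n r : ℕ) : Fin n → ℕ := fun t => if (t : ℕ) = 0 then r else 0

/-- The weight `s·ω_{m-1} = (s, s, …, s)` (as an `SL_m` weight, `m = n+1`). -/
def wtOmegaLast (n s : ℕ) : Fin n → ℕ := fun _ => s

/-- The fundamental weight `ω_k` as an `SL_m` weight, `m = n+1` (`ω_0 = 0` is trivial). -/
def wtOmega (n k : ℕ) : Fin n → ℕ := fun t => if (t : ℕ) < k then 1 else 0

/-- The dual weight `λ* = (λ_1, λ_1 - λ_{m-1}, …, λ_1 - λ_2)`. -/
def dualWt {n : ℕ} (l : Fin n → ℕ) : Fin n → ℕ :=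
  fun i => l ⟨0, i.pos⟩ -
    (if h : (i : ℕ) = 0 then 0 else l ⟨n - (i : ℕ), by have := i.isLt; omega⟩)

end RepCore

section DerivationDet

variable {R A ι κ : Type*} [CommRing R] [CommRing A] [Algebra R A] [DecidableEq ι]

lemma Derivation.finset_sum_apply (s : Finset κ) (D : κ → Derivation R A A) (a : A) :
    (∑ i ∈ s, D i) a = ∑ i ∈ s, D i a := by
  classical
  induction s using Finset.induction_on with
  | empty => simp
  | insert i s hi ih => simp [Finset.sum_insert hi, ih]

lemma Derivation.map_finset_prod (D : Derivation R A A) (s : Finset ι) (f : ι → A) :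
    D (∏ i ∈ s, f i) = ∑ i ∈ s, D (f i) * ∏ j ∈ s.erase i, f j := by
  induction s using Finset.induction_on with
  | empty => simp
  | insert a s ha ih =>
    rw [Finset.prod_insert ha, D.leibniz, ih, Finset.sum_insert ha, Finset.erase_insert ha,
      smul_eq_mul, smul_eq_mul, Finset.mul_sum, add_comm, mul_comm]
    congr 1
    refine Finset.sum_congr rfl fun i hi => ?_
    have hia : a ≠ i := fun h => ha (h ▸ hi)
    rw [Finset.erase_insert_of_ne hia,
      Finset.prod_insert (fun h => ha (Finset.mem_of_mem_erase h))]
    ring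

variable [Fintype ι]

lemma Derivation.map_det_updateCol (D : Derivation R A A) (M : Matrix ι ι A) :
    D M.det = ∑ j, (M.updateCol j (fun i => D (M i j))).det := by
  simp only [Matrix.det_apply, map_sum]
  rw [Finset.sum_comm]
  refine Finset.sum_congr rfl fun σ _ => ?_
  rw [← Finset.smul_sum, Units.smul_def, map_zsmul, D.map_finset_prod]
  congr 1
  refine Finset.sum_congr rfl fun j _ => ?_
  rw [← Finset.mul_prod_erase _ _ (Finset.mem_univ j), Matrix.updateCol_self]
  congr 1
  refine Finset.prod_congr rfl fun l hl => ?_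
  rw [Matrix.updateCol_ne (Finset.ne_of_mem_erase hl)]

lemma Derivation.map_det_updateRow (D : Derivation R A A) (M : Matrix ι ι A) :
    D M.det = ∑ i, (M.updateRow i (fun j => D (M i j))).det := by
  rw [← Matrix.det_transpose, D.map_det_updateCol]
  refine Finset.sum_congr rfl fun i _ => ?_
  rw [Matrix.updateCol_transpose, Matrix.det_transpose]
  rfl

end DerivationDet

section InjectiveIndicator

variable {ι κ M : Type*} [Fintype ι] [DecidableEq κ]

lemma Function.Injective.sum_ite_eq [AddCommMonoid M] {c : ι → κ} (hc : Function.Injective c)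
    (a : κ) (x : M) [Decidable (∃ j, c j = a)] :
    ∑ j, (if c j = a then x else 0) = if ∃ j, c j = a then x else 0 := by
  classical
  split_ifs with h
  · obtain ⟨j, hj⟩ := h
    rw [Finset.sum_eq_single j]
    · rw [if_pos hj]
    · intro b _ hb
      rw [if_neg fun h => hb (hc (h.trans hj.symm))]
    · simp
  · exact Finset.sum_eq_zero fun j _ => if_neg fun hj => h ⟨j, hj⟩

lemma Function.Injective.prod_ite_eq [CommMonoid M] {c : ι → κ} (hc : Function.Injective c)
    (a : κ) (x : M) [Decidable (∃ j, c j = a)] :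
    ∏ j, (if c j = a then x else 1) = if ∃ j, c j = a then x else 1 := by
  classical
  split_ifs with h
  · obtain ⟨j, hj⟩ := h
    rw [Finset.prod_eq_single j]
    · rw [if_pos hj]
    · intro b _ hb
      rw [if_neg fun h => hb (hc (h.trans hj.symm))]
    · simp
  · exact Finset.prod_eq_one fun j _ => if_neg fun hj => h ⟨j, hj⟩

end InjectiveIndicator

noncomputable section LevelOfGenerators

lemma last_ne_zero {n : ℕ} (hn : 1 ≤ n) : (Fin.last n : Fin (n + 1)) ≠ 0 := fun h => by
  have := congrArg Fin.val h
  simp at this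
  omega

/-- The minor of the generic `m × m` matrix on the first `k` rows and the columns `c`. -/
def colMinor {m k : ℕ} (hk : k ≤ m) (c : Fin k → Fin m) : PolyR m :=
  (Matrix.of (fun i j : Fin k => (X (Fin.castLE hk i, c j) : PolyR m))).det

lemma colMinor_eq_zero {m k : ℕ} (hk : k ≤ m) {c : Fin k → Fin m} {j l : Fin k} (hjl : j ≠ l)
    (h : c j = c l) : colMinor hk c = 0 :=
  Matrix.det_zero_of_column_eq hjl fun i => by simp [h]

lemma actA_X {m : ℕ} (g : SLm m) (p : Fin m × Fin m) :
    actA g (X p) = ∑ k : Fin m, C (g.val k p.2) * X (p.1, k) := by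
  simp [actA]

lemma actA_minorP {m k : ℕ} (hk : k ≤ m) (g : SLm m) :
    actA g (minorP m k hk) =
      ∑ c : Fin k → Fin m, (∏ j, g.val (c j) (Fin.castLE hk j)) • colMinor hk c := by
  rw [minorP, AlgHom.map_det, ← Matrix.det_transpose]
  have h : (((actA g).mapMatrix (Matrix.of fun i j : Fin k =>
      (X (Fin.castLE hk i, Fin.castLE hk j) : PolyR m))).transpose) =
      fun j => ∑ l : Fin m, (C (g.val l (Fin.castLE hk j)) : PolyR m) •
        (fun i : Fin k => (X (Fin.castLE hk i, l) : PolyR m)) := by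
    ext j i : 2
    simp [actA_X]
  rw [h]
  change (Matrix.detRowAlternating (R := PolyR m) (n := Fin k)).toMultilinearMap _ = _
  rw [MultilinearMap.map_sum]
  refine Finset.sum_congr rfl fun c _ => ?_
  rw [MultilinearMap.map_smul_univ, ← map_prod, smul_eq_mul, ← smul_eq_C_mul]
  congr 1
  rw [colMinor, ← Matrix.det_transpose]
  rfl

lemma hwv_wtOmega {n k : ℕ} (hk : k ≤ n) :
    hwv (wtOmega n k) = minorP (n + 1) k (by omega) := by
  have hpad : ∀ t : Fin (n + 1), padWt (wtOmega n k) t = if (t : ℕ) < k then 1 else 0 := by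
    intro t
    induction t using Fin.lastCases with
    | last => simp [padWt, hk]
    | cast t => simp [padWt, wtOmega]
  unfold hwv
  rcases Nat.eq_zero_or_pos k with rfl | hpos
  · simp [hpad, minorP]
  · rw [Finset.prod_eq_single (⟨k - 1, by omega⟩ : Fin n)]
    · have h : k - 1 + 1 = k := by omega
      have h' : k - 1 < k := by omega
      simp [hpad, h, h']
    · intro t _ ht
      have h1 : (t : ℕ) + 1 ≠ k := fun h => ht (Fin.ext (by simp; omega))
      have h2 : ((t : ℕ) < k) ↔ ((t : ℕ) + 1 < k) := by omega
      simp [hpad, h2]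
    · simp

lemma Virr_wtOmega_le {n k : ℕ} (hk : k ≤ n) :
    Virr (wtOmega n k) ≤ Submodule.span ℂ
      (colMinor (show k ≤ n + 1 by omega) '' {c | Function.Injective c}) := by
  refine Submodule.span_le.2 ?_
  rintro _ ⟨g, rfl⟩
  rw [hwv_wtOmega hk, actA_minorP]
  refine Submodule.sum_mem _ fun c _ => Submodule.smul_mem _ _ ?_
  by_cases hc : Function.Injective c
  · exact Submodule.subset_span ⟨c, hc, rfl⟩
  · simp only [Function.Injective, not_forall] at hc
    obtain ⟨j, l, h, hjl⟩ := hc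
    rw [colMinor_eq_zero _ hjl h]
    exact Submodule.zero_mem _

/-- The derivation of `ℂ[x_{ij}]` sending the column `a` to the column `b` and killing the
other columns. -/
def colDer {m : ℕ} (a b : Fin m) : Derivation ℂ (PolyR m) (PolyR m) :=
  ∑ i : Fin m, (X (i, b) : PolyR m) • pderiv (i, a)

lemma colDer_X {m : ℕ} (a b : Fin m) (p : Fin m × Fin m) :
    colDer a b (X p) = if p.2 = a then X (p.1, b) else 0 := by
  obtain ⟨r, k⟩ := p
  simp only [colDer, Derivation.finset_sum_apply, Derivation.coe_smul, Pi.smul_apply,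
    pderiv_X, Pi.single_apply, Prod.mk.injEq, smul_eq_mul]
  split_ifs with h
  · simp [h]
  · simp [h]

lemma opE_apply {n : ℕ} (p : PolyR (n + 1)) : opE n p = colDer (Fin.last n) 0 p := by
  simp [opE, colDer, Derivation.finset_sum_apply, LinearMap.sum_apply]

lemma opF_apply {n : ℕ} (p : PolyR (n + 1)) : opF n p = colDer 0 (Fin.last n) p := by
  simp [opF, colDer, Derivation.finset_sum_apply, LinearMap.sum_apply]

lemma opH_apply {n : ℕ} (p : PolyR (n + 1)) :
    opH n p = colDer 0 0 p - colDer (Fin.last n) (Fin.last n) p := by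
  simp [opH, colDer, Derivation.finset_sum_apply, LinearMap.sum_apply]

lemma colDer_colMinor {m k : ℕ} (hk : k ≤ m) (c : Fin k → Fin m) (a b : Fin m) :
    colDer a b (colMinor hk c) =
      ∑ j, if c j = a then colMinor hk (Function.update c j b) else 0 := by
  rw [colMinor, Derivation.map_det_updateCol]
  refine Finset.sum_congr rfl fun j _ => ?_
  split_ifs with h
  · rw [colMinor]
    congr 1
    ext1 i l
    by_cases hl : l = j
    · subst hl
      simp [colDer_X, h]
    · simp [hl]
  · refine Matrix.det_eq_zero_of_column_eq_zero j fun i => ?_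
    simp [colDer_X, h]

lemma colDer_self_colMinor {m k : ℕ} (hk : k ≤ m) {c : Fin k → Fin m}
    (hc : Function.Injective c) (a : Fin m) [Decidable (∃ j, c j = a)] :
    colDer a a (colMinor hk c) = if ∃ j, c j = a then colMinor hk c else 0 := by
  rw [colDer_colMinor, ← hc.sum_ite_eq]
  refine Finset.sum_congr rfl fun j _ => ?_
  split_ifs with h
  · rw [← h, Function.update_eq_self]
  · rfl

lemma colDer_colMinor_of_notMem {m k : ℕ} (hk : k ≤ m) {c : Fin k → Fin m} {a : Fin m}
    (ha : ∀ j, c j ≠ a) (b : Fin m) : colDer a b (colMinor hk c) = 0 := by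
  rw [colDer_colMinor]
  exact Finset.sum_eq_zero fun j _ => if_neg (ha j)

lemma colDer_colMinor_of_mem {m k : ℕ} (hk : k ≤ m) {c : Fin k → Fin m} {a b : Fin m}
    (hab : a ≠ b) (hb : ∃ j, c j = b) : colDer a b (colMinor hk c) = 0 := by
  obtain ⟨l, hl⟩ := hb
  rw [colDer_colMinor]
  refine Finset.sum_eq_zero fun j _ => ?_
  split_ifs with h
  · have hjl : j ≠ l := by
      rintro rfl
      exact hab (h.symm.trans hl)
    exact colMinor_eq_zero hk hjl (by simp [hjl.symm, hl])
  · rfl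

/-- The element of `SL_m(ℂ)`, `m = n + 1`, acting as `-1` in the subgroup `SL_2(ℂ)` attached
to `θ`. -/
def negOne (n : ℕ) : SLm (n + 1) :=
  ⟨Matrix.diagonal fun k => (if k = 0 then -1 else 1) * (if k = Fin.last n then -1 else 1), by
    rw [Matrix.det_diagonal, Finset.prod_mul_distrib]
    simp⟩

lemma actA_negOne_colMinor {n k : ℕ} (hk : k ≤ n + 1) {c : Fin k → Fin (n + 1)}
    (hc : Function.Injective c) [Decidable (∃ j, c j = 0)] [Decidable (∃ j, c j = Fin.last n)] :
    actA (negOne n) (colMinor hk c) =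
      ((if ∃ j, c j = 0 then -1 else 1 : ℂ) * (if ∃ j, c j = Fin.last n then -1 else 1)) •
        colMinor hk c := by
  rw [← hc.prod_ite_eq, ← hc.prod_ite_eq, ← Finset.prod_mul_distrib, smul_eq_C_mul, map_prod,
    colMinor, AlgHom.map_det, ← Matrix.det_mul_row]
  congr 1
  ext1 i j
  simp only [AlgHom.mapMatrix_apply, Matrix.map_apply, Matrix.of_apply]
  rw [actA_X, Finset.sum_eq_single (c j) (fun l _ hl => by simp [negOne, hl]) (by simp)]
  simp [negOne]

lemma colMinor_mem_isoty {n k : ℕ} (hn : 1 ≤ n) (hk : k ≤ n + 1) {c : Fin k → Fin (n + 1)}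
    (hc : Function.Injective c) :
    ∃ d : ℕ, d ≤ 1 ∧ colMinor hk c ∈ isoty n ⊤ d ∧
      actA (negOne n) (colMinor hk c) = ((-1) ^ d : ℂ) • colMinor hk c := by
  classical
  have h0n := last_ne_zero hn
  have hH := opH_apply (colMinor hk c)
  rw [colDer_self_colMinor hk hc, colDer_self_colMinor hk hc] at hH
  have hS := actA_negOne_colMinor hk hc
  by_cases h0 : ∃ j, c j = 0
  · have hE : opE n (colMinor hk c) = 0 := by
      rw [opE_apply, colDer_colMinor_of_mem hk h0n h0]
    by_cases h1 : ∃ j, c j = Fin.last n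
    · refine ⟨0, by omega, Submodule.subset_span ⟨colMinor hk c, 0, trivial, hE, ?_, by simp⟩, ?_⟩
      · simp [hH, h0, h1]
      · simp [hS, h0, h1]
    · refine ⟨1, le_rfl, Submodule.subset_span ⟨colMinor hk c, 0, trivial, hE, ?_, by simp⟩, ?_⟩
      · simp [hH, h0, h1]
      · simp [hS, h0, h1]
  · by_cases h1 : ∃ j, c j = Fin.last n
    · refine ⟨1, le_rfl, ?_, by simp [hS, h0, h1]⟩
      obtain ⟨l, hl⟩ := h1
      set c' := Function.update c l 0 with hc'
      have hc'l : c' l = 0 := by simp [hc']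
      have hc'ne : ∀ j, j ≠ l → c' j = c j := fun j hj => by simp [hc', hj]
      have hc'i : Function.Injective c' := by
        intro a b hab
        by_cases ha : a = l
        · by_cases hb : b = l
          · rw [ha, hb]
          · rw [ha, hc'l, hc'ne b hb] at hab
            exact absurd ⟨b, hab.symm⟩ h0
        · by_cases hb : b = l
          · rw [hb, hc'l, hc'ne a ha] at hab
            exact absurd ⟨a, hab⟩ h0
          · rw [hc'ne a ha, hc'ne b hb] at hab
            exact hc hab
      have hlast : ∀ j, c' j ≠ Fin.last n := by
        intro j hj
        by_cases h : j = l
        · rw [h, hc'l] at hj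
          exact h0n hj.symm
        · rw [hc'ne j h] at hj
          exact h (hc (hj.trans hl.symm))
      refine Submodule.subset_span ⟨colMinor hk c', 1, trivial, ?_, ?_, ?_⟩
      · rw [opE_apply, colDer_colMinor_of_notMem hk hlast]
      · rw [opH_apply, colDer_self_colMinor hk hc'i, colDer_colMinor_of_notMem hk hlast,
          if_pos ⟨l, hc'l⟩]
        simp
      · rw [pow_one, opF_apply, colDer_colMinor, Finset.sum_eq_single l]
        · rw [if_pos hc'l, hc', Function.update_idem, ← hl, Function.update_eq_self]
        · intro j _ hj
          rw [if_neg fun h => h0 ⟨j, (hc'ne j hj).symm.trans h⟩]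
        · simp
    · refine ⟨0, by omega, Submodule.subset_span ⟨colMinor hk c, 0, trivial, ?_, ?_, by simp⟩, ?_⟩
      · rw [opE_apply, colDer_colMinor_of_notMem hk fun j hj => h1 ⟨j, hj⟩]
      · simp [hH, h0, h1]
      · simp [hS, h0, h1]

lemma map_tens3_le {m : ℕ} {A B D : Submodule ℂ (PolyR m)} {S₁ S₂ S₃ : Set (PolyR m)}
    (hA : A ≤ Submodule.span ℂ S₁) (hB : B ≤ Submodule.span ℂ S₂) (hD : D ≤ Submodule.span ℂ S₃)
    {N : Submodule ℂ (T3 m)} (L : T3 m →ₗ[ℂ] T3 m)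
    (h : ∀ a ∈ S₁, ∀ b ∈ S₂, ∀ d ∈ S₃, L (a ⊗ₜ[ℂ] (b ⊗ₜ[ℂ] d)) ∈ N) :
    tens3 A B D ≤ N.comap L := by
  refine Submodule.span_le.2 ?_
  rintro _ ⟨a, ha, b, hb, d, hd, rfl⟩
  replace ha := hA ha
  replace hb := hB hb
  replace hd := hD hd
  show L _ ∈ N
  induction ha using Submodule.span_induction with
  | zero => simp
  | add x y _ _ hx hy => rw [add_tmul, map_add]; exact N.add_mem hx hy
  | smul r x _ hx => rw [← smul_tmul', map_smul]; exact N.smul_mem r hx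
  | mem a ha =>
    induction hb using Submodule.span_induction with
    | zero => simp
    | add x y _ _ hx hy => rw [add_tmul, tmul_add, map_add]; exact N.add_mem hx hy
    | smul r x _ hx => rw [← smul_tmul', tmul_smul, map_smul]; exact N.smul_mem r hx
    | mem b hb =>
      induction hd using Submodule.span_induction with
      | zero => simp
      | add x y _ _ hx hy => rw [tmul_add, tmul_add, map_add]; exact N.add_mem hx hy
      | smul r x _ hx => rw [tmul_smul, tmul_smul, map_smul]; exact N.smul_mem r hx
      | mem d hd => exact h a ha b hb d hd

lemma mem_WKsub_one {n i k j : ℕ} (hn : 1 ≤ n) (hi : i ≤ n) (hk : k ≤ n) (hj : j ≤ n)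
    {T : T3 (n + 1)}
    (hT : T ∈ tens3 (Virr (wtOmega n i)) (Virr (wtOmega n k)) (Virr (wtOmega n j)))
    (hinv : T ∈ InvT3 (n + 1)) : T ∈ WKsub n 1 := by
  have key := map_tens3_le (Virr_wtOmega_le hi) (Virr_wtOmega_le hk) (Virr_wtOmega_le hj)
    (N := WKsub n 1) (LinearMap.id + bigAct (negOne n)) (by
      rintro _ ⟨c₁, h₁, rfl⟩ _ ⟨c₂, h₂, rfl⟩ _ ⟨c₃, h₃, rfl⟩
      obtain ⟨d₁, hd₁, hm₁, hs₁⟩ := colMinor_mem_isoty hn (show i ≤ n + 1 by omega) h₁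
      obtain ⟨d₂, hd₂, hm₂, hs₂⟩ := colMinor_mem_isoty hn (show k ≤ n + 1 by omega) h₂
      obtain ⟨d₃, hd₃, hm₃, hs₃⟩ := colMinor_mem_isoty hn (show j ≤ n + 1 by omega) h₃
      simp only [LinearMap.add_apply, LinearMap.id_apply, bigAct, TensorProduct.map_tmul,
        AlgHom.toLinearMap_apply, hs₁, hs₂, hs₃, ← smul_tmul', tmul_smul, smul_smul, ← pow_add]
      by_cases h : d₁ + d₂ + d₃ ≤ 2
      · have hmem : colMinor (show i ≤ n + 1 by omega) c₁ ⊗ₜ[ℂ]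
            (colMinor (show k ≤ n + 1 by omega) c₂ ⊗ₜ[ℂ]
              colMinor (show j ≤ n + 1 by omega) c₃) ∈ WKsub n 1 := by
          refine Submodule.mem_iSup_of_mem d₁ (Submodule.mem_iSup_of_mem d₂
            (Submodule.mem_iSup_of_mem d₃ (Submodule.mem_iSup_of_mem (by omega) ?_)))
          exact Submodule.subset_span ⟨_, hm₁, _, hm₂, _, hm₃, rfl⟩
        exact Submodule.add_mem _ hmem (Submodule.smul_mem _ _ hmem)
      · obtain rfl : d₁ = 1 := by omega
        obtain rfl : d₂ = 1 := by omega
        obtain rfl : d₃ = 1 := by omega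
        norm_num)
  have h2 : T + bigAct (negOne n) T ∈ WKsub n 1 := key hT
  have h3 : bigAct (negOne n) T = T := (Submodule.mem_iInf _).1 hinv (negOne n)
  rw [h3, ← two_smul ℂ] at h2
  exact (Submodule.smul_mem_iff _ two_ne_zero).1 h2

lemma lie_colDer {m : ℕ} (a b c d : Fin m) :
    ⁅colDer a b, colDer c d⁆ =
      (if d = a then colDer c b else 0) - (if b = c then colDer a d else 0) := by
  refine MvPolynomial.derivation_ext fun p => ?_
  rw [Derivation.commutator_apply, Derivation.sub_apply]
  simp only [colDer_X, apply_ite (colDer _ _), map_zero,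
    apply_ite (fun D : Derivation ℂ (PolyR m) (PolyR m) => D (X p)), Derivation.zero_apply]
  split_ifs <;> simp_all

lemma opE_opF {n : ℕ} (p : PolyR (n + 1)) :
    opE n (opF n p) = opF n (opE n p) + opH n p := by
  have h := congrArg (· p) (lie_colDer (Fin.last n) 0 0 (Fin.last n))
  simp only [Derivation.commutator_apply, if_true, Derivation.sub_apply] at h
  rw [opE_apply, opF_apply, opE_apply, opF_apply, opH_apply, ← h]
  ring

lemma opH_opF {n : ℕ} (hn : 1 ≤ n) (p : PolyR (n + 1)) :
    opH n (opF n p) = opF n (opH n p) - (2 : ℂ) • opF n p := by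
  have h0n := last_ne_zero hn
  have h₁ := congrArg (· p) (lie_colDer (0 : Fin (n + 1)) 0 0 (Fin.last n))
  have h₂ := congrArg (· p) (lie_colDer (Fin.last n) (Fin.last n) 0 (Fin.last n))
  simp only [Derivation.commutator_apply, if_true, if_neg h0n, Derivation.sub_apply,
    Derivation.zero_apply] at h₁ h₂
  rw [opH_apply, opH_apply, opF_apply, opF_apply, map_sub, two_smul]
  linear_combination h₁ - h₂

lemma opF_pow_mul_X {n : ℕ} (hn : 1 ≤ n) (p : PolyR (n + 1)) (x : Fin (n + 1) × Fin (n + 1))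
    (N : ℕ) : (opF n ^ (N + 1)) (p * X x) =
      (opF n ^ (N + 1)) p * X x + (N + 1 : PolyR (n + 1)) * (opF n ^ N) p * opF n (X x) := by
  have h0n := last_ne_zero hn
  have hmul : ∀ q r : PolyR (n + 1), opF n (q * r) = q * opF n r + r * opF n q := by
    intro q r
    simp [opF_apply, Derivation.leibniz]
  have hX : opF n (opF n (X x)) = 0 := by
    rw [opF_apply, opF_apply, colDer_X]
    split_ifs
    · rw [colDer_X, if_neg h0n]
    · simp
  have hN : ∀ N : ℕ, opF n (N + 1 : PolyR (n + 1)) = 0 := by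
    intro N
    rw [opF_apply, ← Nat.cast_succ, Derivation.map_natCast]
  induction N with
  | zero => simp [hmul]; ring
  | succ N ih =>
    rw [pow_succ', Module.End.mul_apply, ih, map_add, hmul, hmul, hmul, hX, hN,
      Module.End.mul_apply, pow_succ' (opF n) N, Module.End.mul_apply]
    push_cast
    ring

lemma exists_opF_pow_eq_zero {n : ℕ} (hn : 1 ≤ n) (p : PolyR (n + 1)) :
    ∃ N : ℕ, (opF n ^ N) p = 0 := by
  have mono : ∀ {q : PolyR (n + 1)} {N M : ℕ}, N ≤ M → (opF n ^ N) q = 0 →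
      (opF n ^ M) q = 0 := by
    intro q N M h hq
    rw [← Nat.sub_add_cancel h, pow_add, Module.End.mul_apply, hq, map_zero]
  induction p using MvPolynomial.induction_on with
  | C a => exact ⟨1, by rw [pow_one, opF_apply, MvPolynomial.derivation_C]⟩
  | add p q hp hq =>
    obtain ⟨N, hN⟩ := hp
    obtain ⟨M, hM⟩ := hq
    exact ⟨max N M, by
      rw [map_add, mono (le_max_left _ _) hN, mono (le_max_right _ _) hM, add_zero]⟩
  | mul_X p x hp =>
    obtain ⟨N, hN⟩ := hp
    exact ⟨N + 1, by rw [opF_pow_mul_X hn, mono N.le_succ hN, hN]; simp⟩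

lemma opF_eq_zero {n : ℕ} (hn : 1 ≤ n) {v : PolyR (n + 1)} (hE : opE n v = 0)
    (hH : opH n v = 0) : opF n v = 0 := by
  have hHk : ∀ k : ℕ, opH n ((opF n ^ k) v) = (-2 * k : ℂ) • (opF n ^ k) v := by
    intro k
    induction k with
    | zero => simpa using hH
    | succ k ih =>
      rw [pow_succ', Module.End.mul_apply, opH_opF hn, ih, map_smul, ← sub_smul]
      congr 1
      push_cast
      ring
  have hEk : ∀ k : ℕ, opE n ((opF n ^ (k + 1)) v) = (-((k + 1) * k) : ℂ) • (opF n ^ k) v := by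
    intro k
    induction k with
    | zero => simp [opE_opF, hE, hH]
    | succ k ih =>
      rw [pow_succ', Module.End.mul_apply, opE_opF, ih, map_smul, ← Module.End.mul_apply,
        ← pow_succ', hHk, ← add_smul]
      congr 1
      push_cast
      ring
  obtain ⟨N, hN⟩ := exists_opF_pow_eq_zero hn v
  induction N with
  | zero => simp_all
  | succ N ih =>
    rcases Nat.eq_zero_or_pos N with rfl | hpos
    · simpa using hN
    · refine ih ?_
      have h := hEk N
      rw [hN, map_zero, eq_comm, smul_eq_zero] at h
      refine h.resolve_left ?_
      have h₁ : (N : ℂ) ≠ 0 := Nat.cast_ne_zero.2 hpos.ne'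
      exact neg_ne_zero.2 (mul_ne_zero (Nat.cast_add_one_ne_zero N) h₁)

lemma isoty_zero_le_ker_opE {n : ℕ} (hn : 1 ≤ n) : isoty n ⊤ 0 ≤ LinearMap.ker (opE n) := by
  refine Submodule.span_le.2 ?_
  rintro _ ⟨v, k, -, hE, hH, rfl⟩
  have hF := opF_eq_zero hn hE (by simpa using hH)
  cases k with
  | zero => simpa using hE
  | succ k => simp [pow_succ, hF]

lemma opE_rTensor_eq_zero {n : ℕ} (hn : 1 ≤ n) {T : T3 (n + 1)} (hT : T ∈ WKsub n 0) :
    (opE n).rTensor _ T = 0 := by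
  have h : WKsub n 0 ≤ LinearMap.ker ((opE n).rTensor (PolyR (n + 1) ⊗[ℂ] PolyR (n + 1))) := by
    refine iSup_le fun i => iSup_le fun j => iSup_le fun k => iSup_le fun hijk => ?_
    obtain rfl : i = 0 := by omega
    refine Submodule.span_le.2 ?_
    rintro _ ⟨a, ha, b, -, c, -, rfl⟩
    have := isoty_zero_le_ker_opE hn ha
    rw [LinearMap.mem_ker] at this
    simp [this]
  exact h hT

lemma actA_inv_actA {m : ℕ} (g : SLm m) (p : PolyR m) : actA g⁻¹ (actA g p) = p := by
  have h : (actA g⁻¹).comp (actA g) = AlgHom.id ℂ (PolyR m) := by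
    refine MvPolynomial.algHom_ext fun p => ?_
    have hmul : (g⁻¹).val * g.val = 1 := by
      rw [← Matrix.SpecialLinearGroup.coe_mul, inv_mul_cancel, Matrix.SpecialLinearGroup.coe_one]
    have hC : ∀ (c : ℂ), actA g⁻¹ (C c) = C c := fun c => (actA g⁻¹).commutes c
    simp only [AlgHom.comp_apply, actA_X, map_sum, map_mul, hC, Finset.mul_sum, AlgHom.id_apply]
    have hsum : ∀ l, ∑ k, C (g.val k p.2) * (C ((g⁻¹).val l k) * X (p.1, l)) =
        C ((1 : Matrix (Fin m) (Fin m) ℂ) l p.2) * (X (p.1, l) : PolyR m) := by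
      intro l
      rw [← hmul, Matrix.mul_apply, map_sum, Finset.sum_mul]
      refine Finset.sum_congr rfl fun k _ => ?_
      rw [map_mul]
      ring
    rw [Finset.sum_comm, Finset.sum_congr rfl fun l _ => hsum l]
    simp [Matrix.one_apply]
  exact congrArg (· p) h

/-- The derivation of `ℂ[x_{ij}]` replacing the first row by the last one and killing the other
rows. -/
def rowDer (n : ℕ) : Derivation ℂ (PolyR (n + 1)) (PolyR (n + 1)) :=
  mkDerivation ℂ fun p => if p.1 = 0 then X (Fin.last n, p.2) else 0

lemma eval_actA {m : ℕ} (g : SLm m) (p : PolyR m) :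
    eval (fun x : Fin m × Fin m => (1 : Matrix (Fin m) (Fin m) ℂ) x.1 x.2) (actA g p) =
      eval (fun x => g.val x.1 x.2) p := by
  have hC : ∀ (c : ℂ), actA g (C c) = C c := fun c => (actA g).commutes c
  induction p using MvPolynomial.induction_on with
  | C a => simp [hC]
  | add p q hp hq => simp [hp, hq]
  | mul_X p x hp =>
    rw [map_mul, map_mul, hp, actA_X, map_mul]
    simp [Matrix.one_apply]

lemma eval_opE_actA {n : ℕ} (g : SLm (n + 1)) (p : PolyR (n + 1)) :
    eval (fun x : Fin (n + 1) × Fin (n + 1) => (1 : Matrix (Fin (n + 1)) (Fin (n + 1)) ℂ) x.1 x.2)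
        (opE n (actA g p)) =
      eval (fun x => g.val x.1 x.2) (rowDer n p) := by
  have hC : ∀ (c : ℂ), actA g (C c) = C c := fun c => (actA g).commutes c
  simp only [opE_apply]
  induction p using MvPolynomial.induction_on with
  | C a => rw [hC, MvPolynomial.derivation_C, MvPolynomial.derivation_C, map_zero, map_zero]
  | add p q hp hq => simp [hp, hq]
  | mul_X p x hp =>
    have hX : eval (fun x : Fin (n + 1) × Fin (n + 1) =>
        (1 : Matrix (Fin (n + 1)) (Fin (n + 1)) ℂ) x.1 x.2)
          (colDer (Fin.last n) 0 (actA g (X x))) =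
        eval (fun x => g.val x.1 x.2) (rowDer n (X x)) := by
      rw [actA_X, map_sum, map_sum, Finset.sum_eq_single (Fin.last n)]
      · rw [C_mul', Derivation.map_smul, colDer_X, rowDer, mkDerivation_X]
        by_cases h : x.1 = 0 <;> simp [h, Matrix.one_apply]
      · intro l _ hl
        rw [C_mul', Derivation.map_smul, colDer_X, if_neg hl]
        simp
      · simp
    rw [map_mul, Derivation.leibniz, Derivation.leibniz, map_add, map_add, smul_eq_mul,
      smul_eq_mul, smul_eq_mul, smul_eq_mul, map_mul, map_mul, map_mul, map_mul, hX, hp, eval_actA,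
      eval_actA]

/-- The substitution moving the first row of variables onto the last one. -/
def firstToLast (n : ℕ) (x : Fin (n + 1) × Fin (n + 1)) : Fin (n + 1) × Fin (n + 1) :=
  (if x.1 = 0 then Fin.last n else x.1, x.2)

/-- The substitution moving the last row of variables onto the first one. -/
def lastToFirst (n : ℕ) (x : Fin (n + 1) × Fin (n + 1)) : Fin (n + 1) × Fin (n + 1) :=
  (if x.1 = Fin.last n then 0 else x.1, x.2)

lemma rowDer_colMinor {n i : ℕ} (hi : 1 ≤ i) (hi' : i ≤ n + 1) (c : Fin i → Fin (n + 1)) :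
    rowDer n (colMinor hi' c) = rename (firstToLast n) (colMinor hi' c) := by
  have : NeZero i := ⟨by omega⟩
  have h0 : ∀ r : Fin i, Fin.castLE hi' r = 0 ↔ r = 0 := by
    exact fun r => ⟨fun h => Fin.ext (by simpa using congrArg Fin.val h),
      fun h => Fin.ext (by simp [h])⟩
  rw [colMinor, Derivation.map_det_updateRow, Finset.sum_eq_single 0, AlgHom.map_det]
  · congr 1
    ext1 r l
    by_cases hr : r = 0
    · subst hr
      simp [rowDer, firstToLast, mkDerivation_X, h0]
    · simp [firstToLast, h0, hr]
  · intro r _ hr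
    refine Matrix.det_eq_zero_of_row_eq_zero r fun l => ?_
    simp [rowDer, mkDerivation_X, h0, hr]
  · simp

lemma rename_lastToFirst_firstToLast_colMinor {n i : ℕ} (hi' : i ≤ n)
    (c : Fin i → Fin (n + 1)) :
    rename (lastToFirst n) (rename (firstToLast n)
      (colMinor (show i ≤ n + 1 by omega) c)) = colMinor (by omega) c := by
  rw [colMinor, AlgHom.map_det, AlgHom.map_det]
  congr 1
  ext1 r l
  have hr : Fin.castLE (show i ≤ n + 1 by omega) r ≠ Fin.last n := by
    simp [Fin.ext_iff]
    omega
  by_cases h0 : Fin.castLE (show i ≤ n + 1 by omega) r = 0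
  · simp [firstToLast, lastToFirst, h0]
  · simp [firstToLast, lastToFirst, h0, hr]

lemma rename_firstToLast_eq_zero {n : ℕ} (hn : 1 ≤ n) {p : PolyR (n + 1)}
    (h : ∀ g : SLm (n + 1), eval (fun x => g.val x.1 x.2) (rename (firstToLast n) p) = 0) :
    rename (firstToLast n) p = 0 := by
  have h0n := last_ne_zero hn
  have hmul : rename (firstToLast n) p *
      (Matrix.mvPolynomialX (Fin (n + 1)) (Fin (n + 1)) ℂ).det = 0 := by
    refine MvPolynomial.funext fun y => ?_
    set Y : Matrix (Fin (n + 1)) (Fin (n + 1)) ℂ := Matrix.of fun r c => y (r, c) with hY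
    have hdet : eval y (Matrix.mvPolynomialX (Fin (n + 1)) (Fin (n + 1)) ℂ).det = Y.det := by
      rw [RingHom.map_det]
      congr 1
      ext r c
      simp [hY]
    rw [map_mul, hdet, map_zero]
    by_cases hd : Y.det = 0
    · rw [hd, mul_zero]
    · have hg := h ⟨Y.updateRow 0 (Y.det⁻¹ • Y 0), by
        rw [Matrix.det_updateRow_smul, Matrix.updateRow_eq_self, inv_mul_cancel₀ hd]⟩
      rw [eval_rename] at hg ⊢
      convert! zero_mul _
      rw [← hg]
      congr 2
      funext x
      have hx : (firstToLast n x).1 ≠ 0 := by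
        unfold firstToLast
        split_ifs with h'
        · exact h0n
        · exact h'
      simp [Function.comp, Matrix.updateRow_ne hx, hY]
  exact (mul_eq_zero.1 hmul).resolve_right (Matrix.det_mvPolynomialX_ne_zero _ _)

lemma eq_zero_of_opE_actA_eq_zero {n i : ℕ} (hi : 1 ≤ i) (hi' : i ≤ n) {a : PolyR (n + 1)}
    (ha : a ∈ Virr (wtOmega n i)) (h : ∀ g : SLm (n + 1), opE n (actA g a) = 0) : a = 0 := by
  have hspan := Virr_wtOmega_le hi' ha
  have h₁ : rowDer n a = rename (firstToLast n) a := by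
    have hle : Submodule.span ℂ (colMinor (show i ≤ n + 1 by omega) '' {c | Function.Injective c})
        ≤ LinearMap.eqLocus (rowDer n).toLinearMap (rename (firstToLast n)).toLinearMap := by
      refine Submodule.span_le.2 ?_
      rintro _ ⟨c, -, rfl⟩
      exact rowDer_colMinor hi _ c
    exact hle hspan
  have h₂ : rename (lastToFirst n) (rename (firstToLast n) a) = a := by
    have hle : Submodule.span ℂ (colMinor (show i ≤ n + 1 by omega) '' {c | Function.Injective c})
        ≤ LinearMap.eqLocus ((rename (R := ℂ) (lastToFirst n)).comp
          (rename (firstToLast n))).toLinearMap LinearMap.id := by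
      refine Submodule.span_le.2 ?_
      rintro _ ⟨c, -, rfl⟩
      exact rename_lastToFirst_firstToLast_colMinor hi' c
    exact hle hspan
  rw [← h₂, rename_firstToLast_eq_zero (hi.trans hi') fun g => ?_, map_zero]
  rw [← h₁, ← eval_opE_actA, h g, map_zero]

lemma notMem_WKsub_zero {n i k j : ℕ} (hi : 1 ≤ i) (hi' : i ≤ n) {T : T3 (n + 1)}
    (hT : T ∈ tens3 (Virr (wtOmega n i)) (Virr (wtOmega n k)) (Virr (wtOmega n j)))
    (hinv : T ∈ InvT3 (n + 1)) (hT0 : T ≠ 0) : T ∉ WKsub n 0 := by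
  intro hW
  have hE := opE_rTensor_eq_zero (hi.trans hi') hW
  have hEg : ∀ g : SLm (n + 1), ((opE n) ∘ₗ (actA g).toLinearMap).rTensor _ T = 0 := by
    intro g
    have hg : bigAct g T = T := (Submodule.mem_iInf _).1 hinv g
    have hcomp : ((opE n) ∘ₗ (actA g).toLinearMap).rTensor (PolyR (n + 1) ⊗[ℂ] PolyR (n + 1)) =
        (TensorProduct.map (actA g⁻¹).toLinearMap (actA g⁻¹).toLinearMap).lTensor _ ∘ₗ
          (opE n).rTensor _ ∘ₗ bigAct g := by
      refine TensorProduct.ext' fun a w => ?_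
      have hinv : (actA g⁻¹).toLinearMap ∘ₗ (actA g).toLinearMap = LinearMap.id :=
        LinearMap.ext (actA_inv_actA g)
      simp only [bigAct, LinearMap.comp_apply, TensorProduct.map_tmul, LinearMap.rTensor_tmul,
        LinearMap.lTensor_tmul]
      rw [← LinearMap.comp_apply (TensorProduct.map _ _), ← TensorProduct.map_comp, hinv,
        TensorProduct.map_id, LinearMap.id_apply]
    rw [hcomp, LinearMap.comp_apply, LinearMap.comp_apply, hg, hE, map_zero]
  let ℬ := Module.Free.chooseBasis ℂ (PolyR (n + 1) ⊗[ℂ] PolyR (n + 1))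
  refine hT0 ((TensorProduct.equivFinsuppOfBasisRight ℬ).injective ?_)
  rw [map_zero]
  ext1 s
  have hslice : ∀ (f : PolyR (n + 1) →ₗ[ℂ] PolyR (n + 1)) (x : T3 (n + 1)),
      f (TensorProduct.equivFinsuppOfBasisRight ℬ x s) =
        TensorProduct.equivFinsuppOfBasisRight ℬ (f.rTensor _ x) s := by
    intro f x
    induction x using TensorProduct.induction_on with
    | zero => simp
    | add x y hx hy => simp only [map_add, Finsupp.add_apply, hx, hy]
    | tmul a w => simp
  refine eq_zero_of_opE_actA_eq_zero hi hi' ?_ fun g => ?_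
  · have hle : tens3 (Virr (wtOmega n i)) (Virr (wtOmega n k)) (Virr (wtOmega n j)) ≤
        (Virr (wtOmega n i)).comap (Finsupp.lapply s ∘ₗ
          (TensorProduct.equivFinsuppOfBasisRight ℬ).toLinearMap) := by
      refine Submodule.span_le.2 ?_
      rintro _ ⟨a, ha, b, -, c, -, rfl⟩
      simpa using Submodule.smul_mem _ _ ha
    exact hle hT
  · have := hslice ((opE n) ∘ₗ (actA g).toLinearMap) T
    rw [hEg g, map_zero] at this
    exact this

lemma vtheta_eq_one {n i k j : ℕ} (hi : 1 ≤ i) (hi' : i ≤ n) (hk : k ≤ n) (hj : j ≤ n)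
    {T : T3 (n + 1)}
    (hT : T ∈ tens3 (Virr (wtOmega n i)) (Virr (wtOmega n k)) (Virr (wtOmega n j)) ⊓
      InvT3 (n + 1)) (hT0 : T ≠ 0) : vtheta T = (1 : WithBot ℕ) := by
  have h1 : T ∈ WKsub n 1 := mem_WKsub_one (hi.trans hi') hi' hk hj hT.1 hT.2
  have h0 : T ∉ WKsub n 0 := notMem_WKsub_zero hi hi' hT.1 hT.2 hT0
  rw [vtheta, if_neg hT0]
  have hle : sInf {K : ℕ | T ∈ WKsub n K} ≤ 1 := Nat.sInf_le h1
  have hmem : T ∈ WKsub n (sInf {K : ℕ | T ∈ WKsub n K}) :=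
    Nat.sInf_mem (s := {K : ℕ | T ∈ WKsub n K}) ⟨1, h1⟩
  have hne : sInf {K : ℕ | T ∈ WKsub n K} ≠ 0 := fun h => h0 (h ▸ hmem)
  rw [show sInf {K : ℕ | T ∈ WKsub n K} = 1 by omega]
  rfl

end LevelOfGenerators

/-- Each generating invariant of the Pieri algebras — the unique
`SL_m(ℂ)`-invariant in `∧^i ℂ^m ⊗ ℂ^m ⊗ ∧^j ℂ^m` (`i + 1 + j ≡ 0 mod m`), in
`∧^i ℂ^m ⊗ ∧^{m-1} ℂ^m ⊗ ∧^j ℂ^m` (`i + (m-1) + j ≡ 0 mod m`), or in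
`∧^i ℂ^m ⊗ ∧^j ℂ^m` (`i + j ≡ 0 mod m`) — has level valuation `v_θ = 1`
(`m = n+1`; `V(ω_k) = ∧^k ℂ^m`). -/
theorem vtheta_generators_eq_one (n : ℕ) (i j : ℕ)
    (hi : 1 ≤ i) (hi' : i ≤ n) (hj : 1 ≤ j) (hj' : j ≤ n) :
    ((i + 1 + j) % (n + 1) = 0 →
      ∀ T ∈ tens3 (Virr (wtOmega n i)) (Virr (wtOmega n 1)) (Virr (wtOmega n j))
          ⊓ InvT3 (n + 1), T ≠ 0 → vtheta T = (1 : WithBot ℕ)) ∧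
    ((i + n + j) % (n + 1) = 0 →
      ∀ T ∈ tens3 (Virr (wtOmega n i)) (Virr (wtOmega n n)) (Virr (wtOmega n j))
          ⊓ InvT3 (n + 1), T ≠ 0 → vtheta T = (1 : WithBot ℕ)) ∧
    ((i + j) % (n + 1) = 0 →
      ∀ T ∈ tens3 (Virr (wtOmega n i)) (Virr (wtOmega n 0)) (Virr (wtOmega n j))
          ⊓ InvT3 (n + 1), T ≠ 0 → vtheta T = (1 : WithBot ℕ)) := by
  exact ⟨fun _ _ hT hT0 => vtheta_eq_one hi hi' (hi.trans hi') hj' hT hT0,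
    fun _ _ hT hT0 => vtheta_eq_one hi hi' le_rfl hj' hT hT0,
    fun _ _ hT hT0 => vtheta_eq_one hi hi' n.zero_le hj' hT hT0⟩
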